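/- arXiv:1801.03742 — 2 statements merged into one kernel-verified Lean document; each statement's English description precedes it below -/
import Mathlib

section
/- Let P be a truncated Gaussian mixture on ℝ^d and set c_1 = √(k·2^{d+2}/((1−η)θ_min)). If σ/B̃ ≤ 1/(16 c_1 √d), then every optimal codebook c* ∈ 𝓜 satisfies, up to relabeling of its codepoints, ‖c*_j − m_j‖ ≤ c_1 σ √d for all j = 1,...,k. -/
open MeasureTheory Metric
open scoped Classical ENNReal NNReal BigOperators RealInnerProductSpace

noncomputable section

namespace Kmeans


variable {H : Type*} [NormedAddCommGroup H] [InnerProductSpace ℝ H]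
  [MeasurableSpace H]

/-- Distortion of a codebook `c` with respect to the measure `P`. -/
def distortion (P : Measure H) (k : ℕ) (c : Fin k → H) : ℝ :=
  ∫ x, (⨅ j : Fin k, ‖x - c j‖ ^ 2) ∂P

/-- The `j`-th closed Voronoi cell of the codebook `c`. -/
def voronoi (k : ℕ) (c : Fin k → H) (j : Fin k) : Set H :=
  {x : H | ∀ i : Fin k, ‖x - c j‖ ≤ ‖x - c i‖}

/-- The set `𝓜` of optimal codebooks, i.e. minimizers of the distortion. -/
def optimal (P : Measure H) (k : ℕ) : Set (Fin k → H) :=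
  {c | ∀ c' : Fin k → H, distortion P k c ≤ distortion P k c'}

/-- `B`: minimal separation between two codepoints of an optimal codebook. -/
def Bsep (P : Measure H) (k : ℕ) : ℝ :=
  sInf {r : ℝ | ∃ c ∈ optimal P k, ∃ i j : Fin k, i ≠ j ∧ r = ‖c i - c j‖}

/-- `p_min`: minimal mass of a Voronoi cell of an optimal codebook. -/
def pmin (P : Measure H) (k : ℕ) : ℝ :=
  sInf {r : ℝ | ∃ c ∈ optimal P k, ∃ j : Fin k, r = (P (voronoi k c j)).toReal}

/-- `N(c)`: the skeleton of the Voronoi diagram of `c`. -/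
def Ncrit (k : ℕ) (c : Fin k → H) : Set H :=
  ⋃ (i : Fin k) (j : Fin k) (_ : i ≠ j), {x : H | ‖x - c i‖ = ‖x - c j‖}

/-- `p(t)`: maximal mass of the `t`-neighborhood of the skeleton of an optimal codebook. -/
def pweight (P : Measure H) (k : ℕ) (t : ℝ) : ℝ :=
  sSup {r : ℝ | ∃ c ∈ optimal P k, r = (P {x : H | infDist x (Ncrit k c) ≤ t}).toReal}

/-- `P` is `M`-bounded: its support is contained in the closed ball of radius `M`. -/
def MBounded (P : Measure H) (M : ℝ) : Prop :=
  P (closedBall (0 : H) M) = 1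

/-- The support of `P` contains more than `k` points. -/
def SupportMoreThan (P : Measure H) (k : ℕ) : Prop :=
  ∃ S : Finset H, k < S.card ∧ ∀ x ∈ S, ∀ ε : ℝ, 0 < ε → 0 < P (ball x ε)

/-- The margin condition with radius `r₀`. -/
def MarginCondition (P : Measure H) (k : ℕ) (M r₀ : ℝ) : Prop :=
  0 < r₀ ∧ MBounded P M ∧
    ∀ t : ℝ, 0 ≤ t → t ≤ r₀ →
      pweight P k t ≤ Bsep P k * pmin P k * t / (128 * M ^ 2)

/-- The cells `W_j(c)` forming a partition subordinated to the Voronoi diagram. -/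
def Wcell (k : ℕ) (c : Fin k → H) (j : Fin k) : Set H :=
  voronoi k c j \ ⋃ (i : Fin k) (_ : i < j), voronoi k c i

/-- `𝓜‾`: codebooks satisfying the centroid condition (stationary points). -/
def stationary (P : Measure H) (k : ℕ) : Set (Fin k → H) :=
  {c | ∀ i : Fin k, (P (Wcell k c i)).toReal • c i = ∫ x in Wcell k c i, x ∂P}

/-- `P` is `ε`-separated. -/
def Separated (P : Measure H) (k : ℕ) (ε : ℝ) : Prop :=
  ∀ c ∈ stationary P k \ optimal P k, ∀ cs ∈ optimal P k,
    ε ≤ distortion P k c - distortion P k cs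

/-- Euclidean distance between codebooks. -/
def cbDist (k : ℕ) (c c' : Fin k → H) : ℝ :=
  Real.sqrt (∑ j : Fin k, ‖c j - c' j‖ ^ 2)

/-- The empirical measure of a sample. -/
def empMeasure {n : ℕ} (X : Fin n → H) : Measure H :=
  ((n : ℝ≥0∞))⁻¹ • ∑ i : Fin n, Measure.dirac (X i)

/-- Number of optimal codebooks up to relabeling of codepoints. -/
def MbarCard (P : Measure H) (k : ℕ) : ℕ :=
  Set.ncard {s : Set (Fin k → H) |
    ∃ c ∈ optimal P k, s = {c' | ∃ π : Equiv.Perm (Fin k), c' = c ∘ π}}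

/-- The mass `p_{ij}(c,t)` of a slab along the segment `[c_i, c_j]` intersected with `V_j(c)`. -/
def pij (P : Measure H) (k : ℕ) (c : Fin k → H) (i j : Fin k) (t : ℝ) : ℝ :=
  (P ({x : H |
      0 ≤ ⟪x - (2⁻¹ : ℝ) • (c i + c j), ‖c i - c j‖⁻¹ • (c j - c i)⟫ ∧
      ⟪x - (2⁻¹ : ℝ) • (c i + c j), ‖c i - c j‖⁻¹ • (c j - c i)⟫ ≤ t} ∩
    voronoi k c j)).toReal

/-- The classification risk between two (ordered) partitions. -/
def classifRisk (P : Measure H) (k : ℕ) (C C' : Fin k → Set H) : ℝ :=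
  sInf {r : ℝ | ∃ π : Equiv.Perm (Fin k),
    r = (P (⋃ j : Fin k, C (π j) ∩ (C' j)ᶜ)).toReal}

/-- A sample is `f`-clusterable. -/
def Clusterable {n : ℕ} (X : Fin n → H) (k : ℕ) (f : ℝ) : Prop :=
  ∃ c ∈ optimal (empMeasure X) k, ∀ i j : Fin k, i ≠ j →
    f * Real.sqrt (distortion (empMeasure X) k c) *
      (1 / Real.sqrt ((Finset.univ.filter fun a => X a ∈ voronoi k c i).card) +
       1 / Real.sqrt ((Finset.univ.filter fun a => X a ∈ voronoi k c j).card))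
      ≤ ‖c i - c j‖

/-- Membership in the class `𝓓(B₋, r₀₋, p₋, ε₋)` of distributions. -/
def inClassD (P : Measure H) (k : ℕ) (M Bm rm pm em : ℝ) : Prop :=
  IsProbabilityMeasure P ∧ SupportMoreThan P k ∧
    (∃ r₀ : ℝ, rm ≤ r₀ ∧ MarginCondition P k M r₀) ∧
    Bm ≤ Bsep P k ∧ pm ≤ pmin P k ∧ Separated P k em



/-- Density of a (non-truncated) Gaussian with mean `m` and covariance matrix `S` on `ℝ^d`. -/
def gaussDensity (d : ℕ) (m : EuclideanSpace ℝ (Fin d)) (S : Matrix (Fin d) (Fin d) ℝ)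
    (x : EuclideanSpace ℝ (Fin d)) : ℝ :=
  ((2 * Real.pi) ^ ((d : ℝ) / 2) * Real.sqrt S.det)⁻¹ *
    Real.exp (-(∑ i : Fin d, (x i - m i) * (S⁻¹.mulVec fun j : Fin d => x j - m j) i) / 2)

/-- The parameters of a Gaussian mixture with `k` components on `ℝ^d`, truncated at radius `M`. -/
structure TGM (d k : ℕ) (M : ℝ) where
  θ : Fin k → ℝ
  m : Fin k → EuclideanSpace ℝ (Fin d)
  S : Fin k → Matrix (Fin d) (Fin d) ℝ
  θ_pos : ∀ i, 0 < θ i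
  θ_sum : ∑ i, θ i = 1
  m_inj : Function.Injective m
  S_posdef : ∀ i, (S i).PosDef
  M_pos : 0 < M
  M_large : ∀ j, 2 * ‖m j‖ ≤ M

namespace TGM

variable {d k : ℕ} {M : ℝ}

/-- `N_i`: the mass the `i`-th untruncated Gaussian puts on `B(0,M)`. -/
def N (G : TGM d k M) (i : Fin k) : ℝ :=
  ∫ x in closedBall (0 : EuclideanSpace ℝ (Fin d)) M, gaussDensity d (G.m i) (G.S i) x

/-- The density of the truncated Gaussian mixture (w.r.t. Lebesgue measure on `B(0,M)`). -/
def density (G : TGM d k M) (x : EuclideanSpace ℝ (Fin d)) : ℝ :=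
  ∑ i, (G.θ i / G.N i) * gaussDensity d (G.m i) (G.S i) x

/-- `P` is the truncated Gaussian mixture with parameters `G`. -/
def IsMixtureOf (G : TGM d k M) (P : Measure (EuclideanSpace ℝ (Fin d))) : Prop :=
  P = (volume.restrict (closedBall (0 : EuclideanSpace ℝ (Fin d)) M)).withDensity
        fun x => ENNReal.ofReal (G.density x)

/-- `B̃`: minimal distance between two means of the mixture. -/
def Btilde (G : TGM d k M) : ℝ :=
  sInf {r : ℝ | ∃ i j : Fin k, i ≠ j ∧ r = ‖G.m i - G.m j‖}

/-- `σ²`: the largest eigenvalue among the covariance matrices. -/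
def sigmaSq (G : TGM d k M) : ℝ :=
  sSup {r : ℝ | ∃ i : Fin k, ∃ v : EuclideanSpace ℝ (Fin d), ‖v‖ = 1 ∧
    r = ∑ a : Fin d, v a * ((G.S i).mulVec fun b : Fin d => v b) a}

/-- `σ₋²`: the smallest eigenvalue among the covariance matrices. -/
def sigmaMinusSq (G : TGM d k M) : ℝ :=
  sInf {r : ℝ | ∃ i : Fin k, ∃ v : EuclideanSpace ℝ (Fin d), ‖v‖ = 1 ∧
    r = ∑ a : Fin d, v a * ((G.S i).mulVec fun b : Fin d => v b) a}

/-- `σ`. -/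
def sigma (G : TGM d k M) : ℝ := Real.sqrt G.sigmaSq

/-- `σ₋`. -/
def sigmaMinus (G : TGM d k M) : ℝ := Real.sqrt G.sigmaMinusSq

/-- `θ_min`. -/
def θmin (G : TGM d k M) : ℝ := ⨅ i : Fin k, G.θ i

/-- `θ_max`. -/
def θmax (G : TGM d k M) : ℝ := ⨆ i : Fin k, G.θ i

/-- `η = max_i (1 - N_i)`. -/
def η (G : TGM d k M) : ℝ := ⨆ i : Fin k, (1 - G.N i)

end TGM

end Kmeans

open Kmeans

variable {H : Type*} [NormedAddCommGroup H] [InnerProductSpace ℝ H]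
  [MeasurableSpace H] [BorelSpace H] [SecondCountableTopology H] [CompleteSpace H]

open Kmeans.TGM

namespace Kmeans

open scoped MatrixOrder in
lemma exists_conjTranspose_mul_self_of_posSemidef {n : Type*} [Fintype n] {S : Matrix n n ℝ}
    (hS : S.PosSemidef) : ∃ B : Matrix n n ℝ, S = B.conjTranspose * B :=
  CStarAlgebra.nonneg_iff_eq_star_mul_self.mp hS.nonneg

lemma inner_toEuclideanLin_eq {d : ℕ} {S B : Matrix (Fin d) (Fin d) ℝ}
    (h : S = B.conjTranspose * B) (v w : EuclideanSpace ℝ (Fin d)) :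
    ∑ a, v a * (S.mulVec fun b => w b) a =
      ⟪Matrix.toEuclideanLin B v, Matrix.toEuclideanLin B w⟫ := by
  have : ∑ a, v a * (S.mulVec fun b => w b) a = (v.ofLp) ⬝ᵥ (S.mulVec w.ofLp) := rfl
  rw [this, h, ← Matrix.mulVec_mulVec, Matrix.dotProduct_mulVec, Matrix.vecMul_conjTranspose]
  simp [EuclideanSpace.inner_eq_star_dotProduct, dotProduct_comm]

lemma norm_sq_le_mul_inv_quadratic {d : ℕ} {S : Matrix (Fin d) (Fin d) ℝ} (hS : S.PosDef)
    {s : ℝ} (hs0 : 0 ≤ s)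
    (hs : ∀ v : EuclideanSpace ℝ (Fin d), ∑ a, v a * (S.mulVec fun b => v b) a ≤ s * ‖v‖ ^ 2)
    (y : EuclideanSpace ℝ (Fin d)) :
    ‖y‖ ^ 2 ≤ s * ∑ a, y a * (S⁻¹.mulVec fun b => y b) a := by
  obtain ⟨C, hC⟩ := exists_conjTranspose_mul_self_of_posSemidef hS.posSemidef
  set K := Matrix.toEuclideanLin C
  let w : EuclideanSpace ℝ (Fin d) := WithLp.toLp 2 (S⁻¹.mulVec y.ofLp)
  have hSw : (S.mulVec fun b => w b) = y.ofLp := by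
    change S.mulVec (S⁻¹.mulVec y.ofLp) = _
    rw [Matrix.mulVec_mulVec, Matrix.mul_nonsing_inv _ hS.det_pos.ne'.isUnit, Matrix.one_mulVec]
  have h1 : ‖y‖ ^ 2 = ⟪K y, K w⟫ := by
    rw [← inner_toEuclideanLin_eq hC, hSw, EuclideanSpace.real_norm_sq_eq]
    simp [sq]
  have h2 : ∑ a, y a * (S⁻¹.mulVec fun b => y b) a = ‖K w‖ ^ 2 := by
    rw [← real_inner_self_eq_norm_sq, ← inner_toEuclideanLin_eq hC, hSw]
    exact Finset.sum_congr rfl fun _ _ => mul_comm _ _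
  have h3 : ‖K y‖ ^ 2 ≤ s * ‖y‖ ^ 2 := by
    rw [← real_inner_self_eq_norm_sq, ← inner_toEuclideanLin_eq hC]
    exact hs y
  rw [h2]
  have h4 : (‖y‖ ^ 2) ^ 2 ≤ ‖K y‖ ^ 2 * ‖K w‖ ^ 2 := by
    rw [← mul_pow, h1]
    exact sq_le_sq.mpr ((abs_real_inner_le_norm _ _).trans (le_abs_self _))
  rcases (sq_nonneg ‖y‖).eq_or_lt with h0 | h0
  · rw [← h0]; positivity
  · have := mul_le_mul_of_nonneg_right h3 (sq_nonneg ‖K w‖)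
    nlinarith

lemma exists_norm_sq_eq_inv_quadratic {d : ℕ} {S : Matrix (Fin d) (Fin d) ℝ} (hS : S.PosDef) :
    ∃ L : EuclideanSpace ℝ (Fin d) →ₗ[ℝ] EuclideanSpace ℝ (Fin d),
      LinearMap.det L ≠ 0 ∧ |(LinearMap.det L)⁻¹| = √S.det ∧
      ∀ y : EuclideanSpace ℝ (Fin d), ∑ a, y a * (S⁻¹.mulVec fun b => y b) a = ‖L y‖ ^ 2 := by
  obtain ⟨B, hB⟩ := exists_conjTranspose_mul_self_of_posSemidef hS.inv.posSemidef
  have hdet : S.det⁻¹ = B.det ^ 2 := by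
    rw [← Ring.inverse_eq_inv', ← Matrix.det_nonsing_inv, hB, Matrix.det_mul,
      Matrix.det_conjTranspose, star_trivial, sq]
  have hpos := hS.det_pos
  refine ⟨Matrix.toEuclideanLin B, ?_, ?_, fun y => ?_⟩
  · rw [LinearMap.det_toLpLin]
    intro h
    rw [h] at hdet
    simp [hpos.ne'] at hdet
  · rw [LinearMap.det_toLpLin, ← Real.sqrt_sq_eq_abs, inv_pow, ← hdet, inv_inv]
  · rw [inner_toEuclideanLin_eq hB, real_inner_self_eq_norm_sq]

lemma integral_exp_neg_mul_norm_sq_linearMap {d : ℕ}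
    (L : EuclideanSpace ℝ (Fin d) →ₗ[ℝ] EuclideanSpace ℝ (Fin d)) (hL : LinearMap.det L ≠ 0)
    {b : ℝ} (hb : 0 < b) (m : EuclideanSpace ℝ (Fin d)) :
    ∫ x, Real.exp (-b * ‖L (x - m)‖ ^ 2) =
      |(LinearMap.det L)⁻¹| * (Real.pi / b) ^ ((d : ℝ) / 2) := by
  rw [integral_sub_right_eq_self (fun x => Real.exp (-b * ‖L x‖ ^ 2)) m]
  have hc : Continuous L := L.continuous_of_finiteDimensional
  have := integral_map (μ := volume) hc.measurable.aemeasurable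
    (f := fun y => Real.exp (-b * ‖y‖ ^ 2))
    (Continuous.aestronglyMeasurable (by fun_prop))
  rw [← this, Measure.map_linearMap_addHaar_eq_smul_addHaar _ hL, integral_smul_measure,
    GaussianFourier.integral_rexp_neg_mul_sq_norm hb, ENNReal.toReal_ofReal (abs_nonneg _)]
  simp

lemma rpow_half_bound {d : ℕ} (hd : 1 ≤ d) :
    (Real.pi / (1 / 2 - 1 / (4 * d))) ^ ((d : ℝ) / 2) ≤
      3 / 2 * (2 * Real.pi) ^ ((d : ℝ) / 2) := by
  have hd' : (1 : ℝ) ≤ d := by exact_mod_cast hd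
  set u : ℝ := 1 - 1 / (2 * d) with hu
  have hu0 : 1 / 2 ≤ u := by
    have : 1 / (2 * (d : ℝ)) ≤ 1 / 2 := by
      apply one_div_le_one_div_of_le <;> linarith
    linarith
  have e : Real.pi / (1 / 2 - 1 / (4 * d)) = 2 * Real.pi / u := by
    have : (1 / 2 - 1 / (4 * d) : ℝ) = u / 2 := by rw [hu]; field_simp; ring
    rw [this]; field_simp
  rw [e, Real.div_rpow (by positivity) (by linarith)]
  have hw : (u ^ ((d : ℝ) / 2)) ^ 2 = u ^ d := by
    rw [← Real.rpow_natCast, ← Real.rpow_mul (by linarith), ← Real.rpow_natCast]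
    congr 1; push_cast; ring
  have hbern : 1 / 2 ≤ u ^ d := by
    have := one_add_mul_le_pow (a := -(1 / (2 * (d : ℝ)))) (by linarith) d
    have e2 : 1 + (d : ℝ) * -(1 / (2 * d)) = 1 / 2 := by field_simp; ring
    rw [e2, ← sub_eq_add_neg] at this
    exact this
  have hw0 : 0 < u ^ ((d : ℝ) / 2) := Real.rpow_pos_of_pos (by linarith) _
  have hZ : 0 < (2 * Real.pi) ^ ((d : ℝ) / 2) := by positivity
  have : 2 / 3 ≤ u ^ ((d : ℝ) / 2) := by nlinarith
  rw [div_le_iff₀ hw0]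
  nlinarith

lemma setIntegral_gaussDensity_mul_norm_sq_le {d : ℕ} (hd : 1 ≤ d)
    {S : Matrix (Fin d) (Fin d) ℝ} (hS : S.PosDef) {s : ℝ} (hs0 : 0 ≤ s)
    (hs : ∀ v : EuclideanSpace ℝ (Fin d), ∑ a, v a * (S.mulVec fun b => v b) a ≤ s * ‖v‖ ^ 2)
    (m : EuclideanSpace ℝ (Fin d)) (A : Set (EuclideanSpace ℝ (Fin d))) :
    ∫ x in A, gaussDensity d m S x * ‖x - m‖ ^ 2 ≤ 2 * (d * s) := by
  obtain ⟨L, hL, hdet, hq⟩ := exists_norm_sq_eq_inv_quadratic hS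
  have hd' : (1 : ℝ) ≤ d := by exact_mod_cast hd
  have hpos := Real.sqrt_pos.mpr hS.det_pos
  have hb : (0 : ℝ) < 1 / 2 - 1 / (4 * d) := by
    have : 1 / (4 * (d : ℝ)) ≤ 1 / 4 := by
      apply one_div_le_one_div_of_le <;> linarith
    linarith
  set Z : ℝ := (2 * Real.pi) ^ ((d : ℝ) / 2) with hZ
  have hZ0 : 0 < Z := by positivity
  have hI (b : ℝ) (hb : 0 < b) : Integrable fun x => Real.exp (-b * ‖L (x - m)‖ ^ 2) := by
    apply Integrable.of_integral_ne_zero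
    rw [integral_exp_neg_mul_norm_sq_linearMap L hL hb, hdet]
    positivity
  set g : EuclideanSpace ℝ (Fin d) → ℝ := fun x => (Z * √S.det)⁻¹ * (4 * d * s) *
    (Real.exp (-(1 / 2 - 1 / (4 * d)) * ‖L (x - m)‖ ^ 2) -
      Real.exp (-(1 / 2) * ‖L (x - m)‖ ^ 2)) with hg
  have hgi : Integrable g := ((hI _ hb).sub (hI _ (by norm_num))).const_mul _
  have hle (x) : gaussDensity d m S x * ‖x - m‖ ^ 2 ≤ g x := by
    have h1 := norm_sq_le_mul_inv_quadratic hS hs0 hs (x - m)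
    rw [hq] at h1
    have h2 : gaussDensity d m S x =
        (Z * √S.det)⁻¹ * Real.exp (-(1 / 2) * ‖L (x - m)‖ ^ 2) := by
      rw [← hq, gaussDensity]
      simp only [PiLp.sub_apply]
      congr 2; ring
    have h3 : Real.exp (-(1 / 2 - 1 / (4 * d)) * ‖L (x - m)‖ ^ 2) =
        Real.exp (-(1 / 2) * ‖L (x - m)‖ ^ 2) * Real.exp (1 / (4 * d) * ‖L (x - m)‖ ^ 2) := by
      rw [← Real.exp_add]; congr 1; ring
    have h4 := Real.add_one_le_exp (1 / (4 * d) * ‖L (x - m)‖ ^ 2)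
    rw [hg]
    simp only
    rw [h2, h3]
    set e := Real.exp (-(1 / 2) * ‖L (x - m)‖ ^ 2)
    set f := Real.exp (1 / (4 * d) * ‖L (x - m)‖ ^ 2)
    have he : 0 < e := Real.exp_pos _
    calc (Z * √S.det)⁻¹ * e * ‖x - m‖ ^ 2
        ≤ (Z * √S.det)⁻¹ * e * (4 * d * s * (f - 1)) := by
          gcongr
          refine h1.trans ?_
          calc s * ‖L (x - m)‖ ^ 2 = 4 * d * s * (1 / (4 * d) * ‖L (x - m)‖ ^ 2) := by
                field_simp
            _ ≤ _ := by gcongr; linarith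
      _ = _ := by ring
  have hnn (x) : 0 ≤ gaussDensity d m S x * ‖x - m‖ ^ 2 := by
    unfold gaussDensity; positivity
  calc ∫ x in A, gaussDensity d m S x * ‖x - m‖ ^ 2 ≤ ∫ x in A, g x :=
        integral_mono_of_nonneg (.of_forall hnn) hgi.integrableOn (.of_forall hle)
    _ ≤ ∫ x, g x := setIntegral_le_integral hgi (.of_forall fun x => (hnn x).trans (hle x))
    _ = (Z * √S.det)⁻¹ * (4 * d * s) *
          (√S.det * (Real.pi / (1 / 2 - 1 / (4 * d))) ^ ((d : ℝ) / 2) - √S.det * Z) := by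
        rw [hg, integral_const_mul, integral_sub (hI _ hb) (hI _ (by norm_num)),
          integral_exp_neg_mul_norm_sq_linearMap L hL hb,
          integral_exp_neg_mul_norm_sq_linearMap L hL (by norm_num), hdet, hZ]
        congr 5; ring
    _ ≤ (Z * √S.det)⁻¹ * (4 * d * s) * (√S.det * (3 / 2 * Z) - √S.det * Z) := by
        gcongr
        exact rpow_half_bound hd
    _ = _ := by field_simp; ring

lemma continuous_gaussDensity {d : ℕ} (m : EuclideanSpace ℝ (Fin d))
    (S : Matrix (Fin d) (Fin d) ℝ) : Continuous (gaussDensity d m S) := by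
  unfold gaussDensity
  simp only [Matrix.mulVec, dotProduct]
  fun_prop

lemma gaussDensity_pos {d : ℕ} (m : EuclideanSpace ℝ (Fin d)) {S : Matrix (Fin d) (Fin d) ℝ}
    (hS : S.PosDef) (x : EuclideanSpace ℝ (Fin d)) : 0 < gaussDensity d m S x := by
  have := hS.det_pos
  unfold gaussDensity
  positivity

lemma integrableOn_closedBall_of_continuous {d : ℕ} {f : EuclideanSpace ℝ (Fin d) → ℝ}
    (hf : Continuous f) (M : ℝ) : IntegrableOn f (closedBall 0 M) :=
  hf.continuousOn.integrableOn_compact (isCompact_closedBall 0 M)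

lemma ciInf_le_of_fintype {k : ℕ} (f : Fin k → ℝ) (j : Fin k) : ⨅ i, f i ≤ f j :=
  ciInf_le (Set.finite_range f).bddBelow j

lemma continuous_ciInf_fin {k : ℕ} [Nonempty (Fin k)] {X : Type*} [TopologicalSpace X]
    {f : Fin k → X → ℝ} (hf : ∀ i, Continuous (f i)) : Continuous fun x => ⨅ i, f i x := by
  have : (fun x => ⨅ i, f i x) =
      fun x => Finset.univ.inf' Finset.univ_nonempty fun i => f i x := by
    funext x
    exact (Finset.inf'_univ_eq_ciInf _).symm
  rw [this]
  exact Continuous.finset_inf'_apply _ fun i _ => hf i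

namespace TGM

variable {d k : ℕ} {M : ℝ}

lemma N_pos (G : TGM d k M) (i : Fin k) : 0 < G.N i := by
  have hpos := gaussDensity_pos (G.m i) (G.S_posdef i)
  have hc := continuous_gaussDensity (G.m i) (G.S i)
  rw [N, setIntegral_pos_iff_support_of_nonneg_ae (.of_forall fun x => (hpos x).le)
    (integrableOn_closedBall_of_continuous hc M)]
  have : Function.support (gaussDensity d (G.m i) (G.S i)) = Set.univ :=
    Set.eq_univ_of_forall fun x => (hpos x).ne'
  rw [this, Set.univ_inter]
  exact measure_closedBall_pos _ _ G.M_pos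

lemma one_sub_η_le_N (G : TGM d k M) (i : Fin k) : 1 - G.η ≤ G.N i := by
  have := le_ciSup (Set.finite_range fun i => 1 - G.N i).bddAbove i
  unfold η
  linarith

lemma one_sub_η_pos [Nonempty (Fin k)] (G : TGM d k M) : 0 < 1 - G.η := by
  obtain ⟨i, hi⟩ := exists_eq_ciSup_of_finite (f := fun i => 1 - G.N i)
  have := G.N_pos i
  unfold η
  rw [← hi]
  linarith

lemma θmin_pos [Nonempty (Fin k)] (G : TGM d k M) : 0 < G.θmin := by
  obtain ⟨i, hi⟩ := exists_eq_ciInf_of_finite (f := G.θ)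
  unfold θmin
  rw [← hi]
  exact G.θ_pos i

lemma θmin_le (G : TGM d k M) (i : Fin k) : G.θmin ≤ G.θ i := ciInf_le_of_fintype _ i

lemma θ_le_one (G : TGM d k M) (i : Fin k) : G.θ i ≤ 1 := by
  rw [← G.θ_sum]
  exact Finset.single_le_sum (fun j _ => (G.θ_pos j).le) (Finset.mem_univ i)

lemma bddAbove_quadratic (G : TGM d k M) :
    BddAbove {r : ℝ | ∃ i : Fin k, ∃ v : EuclideanSpace ℝ (Fin d), ‖v‖ = 1 ∧
      r = ∑ a : Fin d, v a * ((G.S i).mulVec fun b : Fin d => v b) a} := by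
  refine ⟨∑ i, ∑ a, ∑ b, |G.S i a b|, ?_⟩
  rintro _ ⟨i, v, hv, rfl⟩
  have hv1 (a) : |v a| ≤ 1 := by
    rw [← hv]
    exact PiLp.norm_apply_le v a
  calc ∑ a, v a * ((G.S i).mulVec fun b => v b) a
      ≤ ∑ a, ∑ b, |G.S i a b| := by
        refine Finset.sum_le_sum fun a _ => ?_
        rw [Matrix.mulVec, dotProduct, Finset.mul_sum]
        refine Finset.sum_le_sum fun b _ => (le_abs_self _).trans ?_
        rw [abs_mul, abs_mul]
        calc |v a| * (|G.S i a b| * |v b|) ≤ 1 * (|G.S i a b| * 1) := by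
              gcongr <;> apply hv1
          _ = _ := by ring
    _ ≤ _ := Finset.single_le_sum (f := fun i => ∑ a, ∑ b, |G.S i a b|)
        (fun i _ => by positivity) (Finset.mem_univ i)

lemma quadratic_le_sigmaSq (G : TGM d k M) (i : Fin k) (v : EuclideanSpace ℝ (Fin d)) :
    ∑ a, v a * ((G.S i).mulVec fun b => v b) a ≤ G.sigmaSq * ‖v‖ ^ 2 := by
  rcases eq_or_ne v 0 with rfl | hv
  · simp
  have hn : 0 < ‖v‖ := norm_pos_iff.mpr hv
  have h : ∑ a, (‖v‖⁻¹ • v) a * ((G.S i).mulVec fun b => (‖v‖⁻¹ • v) b) a ≤ G.sigmaSq :=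
    le_csSup G.bddAbove_quadratic ⟨i, ‖v‖⁻¹ • v, norm_smul_inv_norm hv, rfl⟩
  have e : ∑ a, (‖v‖⁻¹ • v) a * ((G.S i).mulVec fun b => (‖v‖⁻¹ • v) b) a =
      (‖v‖⁻¹) ^ 2 * ∑ a, v a * ((G.S i).mulVec fun b => v b) a := by
    simp only [PiLp.smul_apply, smul_eq_mul, Matrix.mulVec, dotProduct, Finset.mul_sum]
    refine Finset.sum_congr rfl fun a _ => Finset.sum_congr rfl fun b _ => ?_
    ring
  rw [e, inv_pow, inv_mul_le_iff₀ (by positivity)] at h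
  linarith

lemma sigmaSq_pos [Nonempty (Fin k)] (hd : 1 ≤ d) (G : TGM d k M) : 0 < G.sigmaSq := by
  obtain ⟨i⟩ := ‹Nonempty (Fin k)›
  have h := G.quadratic_le_sigmaSq i (EuclideanSpace.single ⟨0, hd⟩ 1)
  have hp := (G.S_posdef i).diag_pos (i := ⟨0, hd⟩)
  simp [Matrix.mulVec, dotProduct] at h
  linarith

lemma continuous_density (G : TGM d k M) : Continuous G.density := by
  have h i := continuous_gaussDensity (G.m i) (G.S i)
  unfold density
  fun_prop

lemma density_nonneg (G : TGM d k M) (x : EuclideanSpace ℝ (Fin d)) : 0 ≤ G.density x :=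
  Finset.sum_nonneg fun i _ => mul_nonneg (div_nonneg (G.θ_pos i).le (G.N_pos i).le)
    (gaussDensity_pos (G.m i) (G.S_posdef i) x).le

lemma integral_eq_sum {G : TGM d k M} {P : Measure (EuclideanSpace ℝ (Fin d))}
    (hP : G.IsMixtureOf P) {f : EuclideanSpace ℝ (Fin d) → ℝ} (hf : Continuous f) :
    ∫ x, f x ∂P = ∑ i, G.θ i / G.N i *
      ∫ x in closedBall 0 M, gaussDensity d (G.m i) (G.S i) x * f x := by
  rw [show P = _ from hP, integral_withDensity_eq_integral_toReal_smul
    G.continuous_density.measurable.ennreal_ofReal (.of_forall fun _ => ENNReal.ofReal_lt_top)]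
  simp_rw [ENNReal.toReal_ofReal (G.density_nonneg _), smul_eq_mul, density, Finset.sum_mul,
    mul_assoc]
  rw [integral_finsetSum]
  · simp only [integral_const_mul]
  · intro i _
    exact (integrableOn_closedBall_of_continuous
      ((continuous_gaussDensity (G.m i) (G.S i)).mul hf) M).const_mul _

lemma truncated_second_moment_le [Nonempty (Fin k)] (hd : 1 ≤ d) (G : TGM d k M) (i : Fin k) :
    ∫ x in closedBall 0 M, gaussDensity d (G.m i) (G.S i) x * ‖x - G.m i‖ ^ 2 ≤
      2 * (d * G.sigmaSq) :=
  setIntegral_gaussDensity_mul_norm_sq_le hd (G.S_posdef i) (G.sigmaSq_pos hd).le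
    (G.quadratic_le_sigmaSq i) _ _

lemma div_N_mul_truncated_second_moment_le [Nonempty (Fin k)] (hd : 1 ≤ d) (G : TGM d k M)
    (i : Fin k) :
    G.θ i / G.N i *
      ∫ x in closedBall 0 M, gaussDensity d (G.m i) (G.S i) x * ‖x - G.m i‖ ^ 2 ≤
      G.θ i * (2 * (d * G.sigmaSq / (1 - G.η))) := by
  have hθ := G.θ_pos i
  have hη := G.one_sub_η_pos
  have hs := G.sigmaSq_pos hd
  calc _ ≤ G.θ i / G.N i * (2 * (d * G.sigmaSq)) := by
        gcongr
        · exact div_nonneg hθ.le (G.N_pos i).le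
        · exact G.truncated_second_moment_le hd i
    _ ≤ G.θ i / (1 - G.η) * (2 * (d * G.sigmaSq)) := by
        gcongr
        exact G.one_sub_η_le_N i
    _ = _ := by ring

lemma continuous_ciInf_norm_sub_sq [Nonempty (Fin k)] (c : Fin k → EuclideanSpace ℝ (Fin d)) :
    Continuous fun x => ⨅ j, ‖x - c j‖ ^ 2 :=
  continuous_ciInf_fin fun _ => by fun_prop

/-- The means form a codebook of small distortion. -/
lemma distortion_means_le [Nonempty (Fin k)] (hd : 1 ≤ d) {G : TGM d k M}
    {P : Measure (EuclideanSpace ℝ (Fin d))} (hP : G.IsMixtureOf P) :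
    distortion P k G.m ≤ 2 * (d * G.sigmaSq / (1 - G.η)) := by
  rw [distortion, integral_eq_sum hP (continuous_ciInf_norm_sub_sq _)]
  calc _ ≤ ∑ i, G.θ i * (2 * (d * G.sigmaSq / (1 - G.η))) := by
        refine Finset.sum_le_sum fun i _ =>
          le_trans ?_ (G.div_N_mul_truncated_second_moment_le hd i)
        have hg := continuous_gaussDensity (G.m i) (G.S i)
        refine mul_le_mul_of_nonneg_left ?_ (div_nonneg (G.θ_pos i).le (G.N_pos i).le)
        refine setIntegral_mono
          (integrableOn_closedBall_of_continuous (hg.mul (continuous_ciInf_norm_sub_sq _)) M)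
          (integrableOn_closedBall_of_continuous (hg.mul (by fun_prop)) M) fun x => ?_
        exact mul_le_mul_of_nonneg_left (ciInf_le_of_fintype (fun j => ‖x - G.m j‖ ^ 2) i)
          (gaussDensity_pos _ (G.S_posdef i) x).le
    _ = _ := by rw [← Finset.sum_mul, G.θ_sum, one_mul]

/-- A codebook that misses a mean has large distortion. -/
lemma le_distortion_of_far [Nonempty (Fin k)] (hd : 1 ≤ d) {G : TGM d k M}
    {P : Measure (EuclideanSpace ℝ (Fin d))} (hP : G.IsMixtureOf P)
    {c : Fin k → EuclideanSpace ℝ (Fin d)} {j : Fin k} {r : ℝ} (hr : 0 ≤ r)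
    (hfar : ∀ i, r ≤ ‖c i - G.m j‖) :
    G.θ j * (r ^ 2 / 2) - G.θ j * (2 * (d * G.sigmaSq / (1 - G.η))) ≤ distortion P k c := by
  have hcont := continuous_ciInf_norm_sub_sq c
  have hinf (x) : 0 ≤ ⨅ i, ‖x - c i‖ ^ 2 := Real.iInf_nonneg fun i => sq_nonneg _
  have hw (i) : 0 ≤ G.θ i / G.N i := div_nonneg (G.θ_pos i).le (G.N_pos i).le
  have hg := continuous_gaussDensity (G.m j) (G.S j)
  have hN := G.N_pos j
  rw [distortion, integral_eq_sum hP hcont]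
  refine le_trans ?_ (Finset.single_le_sum (fun i _ => mul_nonneg (hw i)
    (integral_nonneg fun x => mul_nonneg (gaussDensity_pos _ (G.S_posdef i) x).le (hinf x)))
    (Finset.mem_univ j))
  have hlow (x) : r ^ 2 / 2 - ‖x - G.m j‖ ^ 2 ≤ ⨅ i, ‖x - c i‖ ^ 2 := by
    refine le_ciInf fun i => ?_
    have h1 : r ≤ ‖x - c i‖ + ‖x - G.m j‖ := by
      refine (hfar i).trans ?_
      rw [norm_sub_rev x (c i)]
      exact norm_sub_le_norm_sub_add_norm_sub _ _ _
    have h2 : r ^ 2 ≤ (‖x - c i‖ + ‖x - G.m j‖) ^ 2 := by gcongr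
    nlinarith [sq_nonneg (‖x - c i‖ - ‖x - G.m j‖)]
  have hi1 := (integrableOn_closedBall_of_continuous hg M).mul_const (r ^ 2 / 2)
  have hi2 : IntegrableOn (fun x => gaussDensity d (G.m j) (G.S j) x * ‖x - G.m j‖ ^ 2)
      (closedBall 0 M) :=
    integrableOn_closedBall_of_continuous (by fun_prop) M
  calc _ ≤ G.θ j * (r ^ 2 / 2) - G.θ j / G.N j *
          ∫ x in closedBall 0 M, gaussDensity d (G.m j) (G.S j) x * ‖x - G.m j‖ ^ 2 := by
        exact sub_le_sub_left (G.div_N_mul_truncated_second_moment_le hd j) _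
    _ = G.θ j / G.N j * ((G.N j) * (r ^ 2 / 2) -
          ∫ x in closedBall 0 M, gaussDensity d (G.m j) (G.S j) x * ‖x - G.m j‖ ^ 2) := by
        field_simp
    _ = G.θ j / G.N j * ∫ x in closedBall 0 M, (gaussDensity d (G.m j) (G.S j) x * (r ^ 2 / 2) -
          gaussDensity d (G.m j) (G.S j) x * ‖x - G.m j‖ ^ 2) := by
        rw [integral_sub hi1 hi2, integral_mul_const, N]
    _ ≤ _ := by
        refine mul_le_mul_of_nonneg_left ?_ (hw j)
        refine setIntegral_mono (hi1.sub hi2)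
          (integrableOn_closedBall_of_continuous (hg.mul hcont) M) fun x => ?_
        rw [← mul_sub]
        exact mul_le_mul_of_nonneg_left (hlow x) (gaussDensity_pos _ (G.S_posdef j) x).le

lemma Btilde_le (G : TGM d k M) {i j : Fin k} (hij : i ≠ j) :
    G.Btilde ≤ ‖G.m i - G.m j‖ :=
  csInf_le ⟨0, by rintro _ ⟨i, j, -, rfl⟩; positivity⟩ ⟨i, j, hij, rfl⟩

lemma Btilde_pos (hk : 2 ≤ k) (G : TGM d k M) : 0 < G.Btilde := by
  set s := {r : ℝ | ∃ i j : Fin k, i ≠ j ∧ r = ‖G.m i - G.m j‖}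
  have hne : s.Nonempty := ⟨_, ⟨0, by omega⟩, ⟨1, by omega⟩, by simp, rfl⟩
  have hfin : s.Finite := by
    refine (Set.finite_range fun p : Fin k × Fin k => ‖G.m p.1 - G.m p.2‖).subset ?_
    rintro _ ⟨i, j, -, rfl⟩
    exact ⟨(i, j), rfl⟩
  obtain ⟨i, j, hij, h⟩ := hne.csInf_mem hfin
  rw [Btilde, h, norm_pos_iff, sub_ne_zero]
  exact G.m_inj.ne hij

end TGM

end Kmeans

/-- optimal codepoints of a well-separated truncated Gaussian
mixture are close to the means. -/
theorem optimal_codepoints_close_to_means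
    (d k : ℕ) (hd : 1 ≤ d) (hk : 2 ≤ k) (M cconst : ℝ) (G : TGM d k M)
    (P : Measure (EuclideanSpace ℝ (Fin d))) [IsProbabilityMeasure P]
    (hP : G.IsMixtureOf P) (hc : 0 < cconst) (hMσ : M ≤ cconst * G.sigma)
    (c₁ : ℝ)
    (hc₁ : c₁ = Real.sqrt ((k : ℝ) * 2 ^ (d + 2) / ((1 - G.η) * G.θmin)))
    (hsep : G.sigma / G.Btilde ≤ 1 / (16 * c₁ * Real.sqrt d)) :
    ∀ cs ∈ optimal P k, ∃ π : Equiv.Perm (Fin k),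
      ∀ j : Fin k, ‖cs (π j) - G.m j‖ ≤ c₁ * G.sigma * Real.sqrt d := by
  intro cs hcs
  have : Nonempty (Fin k) := ⟨⟨0, by omega⟩⟩
  have hη := G.one_sub_η_pos
  have hθ := G.θmin_pos
  have hs := G.sigmaSq_pos hd
  have hσ : 0 < G.sigma := Real.sqrt_pos.mpr hs
  have hσ2 : G.sigma ^ 2 = G.sigmaSq := Real.sq_sqrt hs.le
  have hB := G.Btilde_pos hk
  have hd0 : (0 : ℝ) < d := by exact_mod_cast hd
  have hk2 : (2 : ℝ) ≤ k := by exact_mod_cast hk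
  have hc₁pos : 0 < c₁ := by rw [hc₁]; positivity
  have hc₁sq : c₁ ^ 2 = (k : ℝ) * 2 ^ (d + 2) / ((1 - G.η) * G.θmin) := by
    rw [hc₁]; exact Real.sq_sqrt (by positivity)
  set r := c₁ * G.sigma * √d with hr
  have hr0 : 0 < r := by positivity
  have hr2 : G.θmin * r ^ 2 = k * 2 ^ (d + 2) * (d * G.sigmaSq / (1 - G.η)) := by
    rw [hr, mul_pow, mul_pow, Real.sq_sqrt hd0.le, hσ2, hc₁sq]
    field_simp
  have hkd : (16 : ℝ) ≤ k * 2 ^ (d + 2) := by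
    have : (2 : ℝ) ^ 3 ≤ 2 ^ (d + 2) := pow_le_pow_right₀ (by norm_num) (by omega)
    nlinarith
  have hBr : 16 * r ≤ G.Btilde := by
    rw [div_le_div_iff₀ hB (by positivity)] at hsep
    linarith
  have hnear (j : Fin k) : ∃ i, ‖cs i - G.m j‖ ≤ r := by
    by_contra! hfar
    have hlow := le_distortion_of_far hd hP hr0.le fun i => (hfar i).le
    have hup := (hcs G.m).trans (distortion_means_le hd hP)
    set D := d * G.sigmaSq / (1 - G.η)
    have hD : 0 < D := by positivity
    have h1 : G.θmin * r ^ 2 ≤ G.θ j * r ^ 2 := by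
      gcongr
      exact G.θmin_le j
    have h2 := mul_le_mul_of_nonneg_right hkd hD.le
    have h3 := mul_le_mul_of_nonneg_right (G.θ_le_one j) hD.le
    linarith
  choose f hf using hnear
  have hinj : Function.Injective f := by
    intro i j hij
    by_contra hne
    have h1 := G.Btilde_le hne
    have h2 := norm_sub_le_norm_sub_add_norm_sub (G.m i) (cs (f i)) (G.m j)
    have h3 := hf i
    have h4 := hf j
    rw [norm_sub_rev] at h3
    rw [← hij] at h4
    linarith
  exact ⟨Equiv.ofBijective f (Finite.injective_iff_bijective.mp hinj), hf⟩
end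
end

section
/- Assume P satisfies a margin condition with radius r_0. Then the set 𝓜 of optimal codebooks is finite, and there exists ε > 0 such that P is ε-separated. -/
open MeasureTheory Metric
open scoped Classical ENNReal NNReal BigOperators RealInnerProductSpace

noncomputable section

namespace Kmeans

open Filter Topology

section Pointwise

variable {H : Type*} [NormedAddCommGroup H] {k : ℕ}

theorem iInf_sq_le (c : Fin k → H) (x : H) (j : Fin k) :
    ⨅ i, ‖x - c i‖ ^ 2 ≤ ‖x - c j‖ ^ 2 :=
  ciInf_le (Set.finite_range _).bddBelow j

theorem iInf_sq_nonneg (c : Fin k → H) (x : H) : 0 ≤ ⨅ i, ‖x - c i‖ ^ 2 :=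
  Real.iInf_nonneg fun _ => sq_nonneg _

theorem iInf_sq_eq_of_mem_voronoi {c : Fin k → H} {x : H} {j : Fin k}
    (hx : x ∈ voronoi k c j) : ⨅ i, ‖x - c i‖ ^ 2 = ‖x - c j‖ ^ 2 := by
  have : Nonempty (Fin k) := ⟨j⟩
  refine le_antisymm (iInf_sq_le c x j) (le_ciInf fun i => ?_)
  exact pow_le_pow_left₀ (norm_nonneg _) (hx i) 2

theorem Wcell_subset_voronoi (c : Fin k → H) (j : Fin k) : Wcell k c j ⊆ voronoi k c j :=
  Set.sdiff_subset

theorem exists_mem_voronoi [Nonempty (Fin k)] (c : Fin k → H) (x : H) :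
    ∃ j, x ∈ voronoi k c j := by
  obtain ⟨j, hj⟩ := Finite.exists_min fun j => ‖x - c j‖
  exact ⟨j, hj⟩

theorem exists_mem_Wcell [Nonempty (Fin k)] (c : Fin k → H) (x : H) :
    ∃ j, x ∈ Wcell k c j := by
  obtain ⟨j, hj, hmin⟩ := WellFounded.has_min (wellFounded_lt (α := Fin k))
    {j | x ∈ voronoi k c j} (exists_mem_voronoi c x)
  refine ⟨j, hj, ?_⟩
  simp only [Set.mem_iUnion, not_exists]
  exact fun i hi hx => hmin i hx hi

theorem isClosed_voronoi (c : Fin k → H) (j : Fin k) : IsClosed (voronoi k c j) := by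
  have : voronoi k c j = ⋂ i, {x | ‖x - c j‖ ≤ ‖x - c i‖} := by
    ext; simp [voronoi]
  rw [this]
  exact isClosed_iInter fun i => isClosed_le (by fun_prop) (by fun_prop)

theorem mem_Ncrit_of_mem_voronoi {c : Fin k → H} {x : H} {i j : Fin k} (hij : i ≠ j)
    (hi : x ∈ voronoi k c i) (hj : x ∈ voronoi k c j) : x ∈ Ncrit k c := by
  simp only [Ncrit, Set.mem_iUnion]
  exact ⟨i, j, hij, le_antisymm (hi j) (hj i)⟩

theorem voronoi_diff_Wcell_subset (c : Fin k → H) (j : Fin k) :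
    voronoi k c j \ Wcell k c j ⊆ Ncrit k c := by
  rintro x ⟨hx, hx'⟩
  simp only [Wcell, Set.mem_sdiff, hx, true_and, not_not, Set.mem_iUnion] at hx'
  obtain ⟨i, hi, hxi⟩ := hx'
  exact mem_Ncrit_of_mem_voronoi hi.ne hxi hx

theorem infDist_Ncrit_le [InnerProductSpace ℝ H] {s : Fin k → H} {i j : Fin k}
    (hij : s i ≠ s j) {x : H} {D : ℝ}
    (hji : ‖x - s j‖ ≤ ‖x - s i‖)
    (hD : ‖x - s i‖ ^ 2 - ‖x - s j‖ ^ 2 ≤ 2 * D * ‖s i - s j‖) :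
    infDist x (Ncrit k s) ≤ D := by
  set u := s i - s j with hu
  set f := ‖x - s i‖ ^ 2 - ‖x - s j‖ ^ 2 with hf
  have hu0 : 0 < ‖u‖ := norm_pos_iff.2 (sub_ne_zero.2 hij)
  have hf0 : 0 ≤ f := by
    have := pow_le_pow_left₀ (norm_nonneg _) hji 2
    linarith
  set y := x + (f / (2 * ‖u‖ ^ 2)) • u with hy
  have hmem : y ∈ Ncrit k s := by
    simp only [Ncrit, Set.mem_iUnion]
    refine ⟨i, j, fun h => hij (by rw [h]), ?_⟩
    have e1 : y - s j = (x - s i) + (f / (2 * ‖u‖ ^ 2) + 1) • u := by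
      rw [hy, hu]; module
    have e2 : y - s i = (x - s i) + (f / (2 * ‖u‖ ^ 2)) • u := by
      rw [hy]; module
    have e3 : x - s j = (x - s i) + u := by rw [hu]; module
    have h3 : f = ‖x - s i‖ ^ 2 - ‖(x - s i) + u‖ ^ 2 := by rw [hf, e3]
    have hin : 2 * ⟪x - s i, u⟫ = - f - ‖u‖ ^ 2 := by
      rw [h3, norm_add_sq_real]; ring
    have : ‖y - s i‖ ^ 2 = ‖y - s j‖ ^ 2 := by
      rw [e1, e2, norm_add_sq_real, norm_add_sq_real, inner_smul_right, inner_smul_right,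
        norm_smul, norm_smul, mul_pow, mul_pow, Real.norm_eq_abs, Real.norm_eq_abs, sq_abs, sq_abs]
      have : f / (2 * ‖u‖ ^ 2) * ‖u‖ ^ 2 = f / 2 := by field_simp
      linear_combination (-1 : ℝ) * hin - 2 * this
    exact (sq_eq_sq₀ (norm_nonneg _) (norm_nonneg _)).1 this
  refine (infDist_le_dist_of_mem hmem).trans ?_
  rw [dist_eq_norm]
  have e : x - y = -((f / (2 * ‖u‖ ^ 2)) • u) := by rw [hy]; module
  rw [e, norm_neg, norm_smul, Real.norm_of_nonneg (by positivity)]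
  have : f / (2 * ‖u‖ ^ 2) * ‖u‖ = f / (2 * ‖u‖) := by field_simp
  rw [this, div_le_iff₀ (by positivity)]
  linarith

theorem measurableSet_Wcell [MeasurableSpace H] [OpensMeasurableSpace H] (c : Fin k → H)
    (j : Fin k) : MeasurableSet (Wcell k c j) :=
  (isClosed_voronoi c j).measurableSet.diff <|
    MeasurableSet.iUnion fun i => MeasurableSet.iUnion fun _ => (isClosed_voronoi c i).measurableSet

end Pointwise

section Distortion

variable {H : Type*} [NormedAddCommGroup H] [MeasurableSpace H] [BorelSpace H]
  {P : Measure H} {k : ℕ} {M : ℝ}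

theorem measurable_iInf_sq (c : Fin k → H) : Measurable fun x => ⨅ j, ‖x - c j‖ ^ 2 :=
  Measurable.iInf fun j => by fun_prop

theorem MBounded.ae_norm_le [IsProbabilityMeasure P] (h : MBounded P M) :
    ∀ᵐ x ∂P, ‖x‖ ≤ M := by
  have := (prob_compl_eq_zero_iff isClosed_closedBall.measurableSet).2 h
  filter_upwards [compl_mem_ae_iff.2 this] with x hx
  simpa using hx

theorem MBounded.integrable_iInf_sq [IsProbabilityMeasure P] [Nonempty (Fin k)]
    (h : MBounded P M) (c : Fin k → H) : Integrable (fun x => ⨅ j, ‖x - c j‖ ^ 2) P := by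
  obtain ⟨j⟩ := ‹Nonempty (Fin k)›
  refine Integrable.of_bound (measurable_iInf_sq c).aestronglyMeasurable ((M + ‖c j‖) ^ 2) ?_
  filter_upwards [h.ae_norm_le] with x hx
  rw [Real.norm_of_nonneg (iInf_sq_nonneg c x)]
  refine (iInf_sq_le c x j).trans (pow_le_pow_left₀ (norm_nonneg _) ?_ 2)
  exact (norm_sub_le _ _).trans (by linarith)

theorem MBounded.integrable_id [SecondCountableTopology H] [IsProbabilityMeasure P] (h : MBounded P M) :
    Integrable (fun x : H => x) P :=
  Integrable.of_bound measurable_id.aestronglyMeasurable M h.ae_norm_le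

/-- A codebook whose distortion integrand is almost everywhere dominated by that of an optimal
codebook has almost everywhere the same integrand. -/
theorem ae_eq_of_optimal_of_ae_le [IsProbabilityMeasure P] [Nonempty (Fin k)] (hb : MBounded P M)
    {c c' : Fin k → H} (hc : c ∈ optimal P k)
    (h : ∀ᵐ x ∂P, ⨅ j, ‖x - c' j‖ ^ 2 ≤ ⨅ j, ‖x - c j‖ ^ 2) :
    ∀ᵐ x ∂P, ⨅ j, ‖x - c' j‖ ^ 2 = ⨅ j, ‖x - c j‖ ^ 2 := by
  have hi := hb.integrable_iInf_sq (k := k)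
  refine (integral_eq_iff_of_ae_le (hi c') (hi c) h).1 (le_antisymm ?_ (hc c'))
  exact integral_mono_ae (hi c') (hi c) h

/-- Every Voronoi cell of an optimal codebook has positive mass. -/
theorem measure_voronoi_ne_zero [IsProbabilityMeasure P] [Nonempty (Fin k)] (hb : MBounded P M)
    (hsupp : SupportMoreThan P k) {c : Fin k → H} (hc : c ∈ optimal P k) (i : Fin k) :
    P (voronoi k c i) ≠ 0 := by
  intro h0
  obtain ⟨S, hcard, hS⟩ := hsupp
  obtain ⟨y, hyS, hy⟩ : ∃ y ∈ S, y ∉ Finset.univ.image c := by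
    refine Finset.exists_mem_notMem_of_card_lt_card (lt_of_le_of_lt ?_ hcard)
    simpa using Finset.card_image_le (s := Finset.univ) (f := c)
  have hy' : ∀ j, 0 < ‖y - c j‖ := fun j =>
    norm_pos_iff.2 (sub_ne_zero.2 fun h => hy (by simp [h]))
  obtain ⟨j₀, hj₀⟩ := Finite.exists_min fun j => ‖y - c j‖
  have hle : ∀ᵐ x ∂P,
      ⨅ j, ‖x - Function.update c i y j‖ ^ 2 ≤ ⨅ j, ‖x - c j‖ ^ 2 := by
    filter_upwards [compl_mem_ae_iff.2 h0] with x hx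
    obtain ⟨l, hl⟩ := exists_mem_voronoi c x
    have hli : l ≠ i := fun h => hx (h ▸ hl)
    rw [iInf_sq_eq_of_mem_voronoi hl]
    simpa [hli] using iInf_sq_le (Function.update c i y) x l
  refine (hS y hyS (‖y - c j₀‖ / 2) (half_pos (hy' j₀))).ne' ?_
  refine measure_mono_null (fun x hx => ?_) (ae_eq_of_optimal_of_ae_le hb hc hle)
  rw [mem_ball, dist_eq_norm] at hx
  obtain ⟨l, hl⟩ := exists_mem_voronoi c x
  have h1 : ⨅ j, ‖x - Function.update c i y j‖ ^ 2 ≤ ‖x - y‖ ^ 2 := by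
    simpa using iInf_sq_le (Function.update c i y) x i
  have h2 : ‖x - y‖ < ‖x - c l‖ := by
    have := norm_sub_le_norm_sub_add_norm_sub y x (c l)
    rw [norm_sub_rev y x] at this
    linarith [hj₀ l]
  have h3 := pow_lt_pow_left₀ h2 (norm_nonneg _) two_ne_zero
  rw [Set.mem_compl_iff, Set.mem_ofPred_eq, iInf_sq_eq_of_mem_voronoi hl]
  exact (h1.trans_lt h3).ne

/-- Optimal codebooks satisfy the centroid condition. -/
theorem optimal_subset_stationary [InnerProductSpace ℝ H] [SecondCountableTopology H]
    [CompleteSpace H] [IsProbabilityMeasure P] [Nonempty (Fin k)]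
    (hb : MBounded P M) : optimal P k ⊆ stationary P k := by
  intro c hc i
  by_cases h0 : P (Wcell k c i) = 0
  · rw [Measure.restrict_eq_zero.2 h0]
    simp [h0]
  set W := Wcell k c i with hW
  have hWm : MeasurableSet W := measurableSet_Wcell c i
  set p := (P W).toReal with hp
  have hp0 : 0 < p := ENNReal.toReal_pos h0 (measure_ne_top _ _)
  set m := p⁻¹ • ∫ x in W, x ∂P with hm
  have hpm : ∫ x in W, x ∂P = p • m := by rw [hm, smul_inv_smul₀ hp0.ne']
  have hid := hb.integrable_id
  have hpt : ∀ x : H, ⨅ j, ‖x - Function.update c i m j‖ ^ 2 ≤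
      (⨅ j, ‖x - c j‖ ^ 2) -
        W.indicator (fun x => ‖c i‖ ^ 2 - ‖m‖ ^ 2 - 2 * ⟪c i - m, x⟫) x := by
    intro x
    by_cases hx : x ∈ W
    · rw [Set.indicator_of_mem hx, iInf_sq_eq_of_mem_voronoi (Wcell_subset_voronoi c i hx)]
      have := iInf_sq_le (Function.update c i m) x i
      rw [Function.update_self] at this
      refine this.trans (le_of_eq ?_)
      rw [norm_sub_sq_real, norm_sub_sq_real, inner_sub_left, real_inner_comm x m,
        real_inner_comm x (c i)]
      ring
    · rw [Set.indicator_of_notMem hx, sub_zero]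
      obtain ⟨l, hl⟩ := exists_mem_Wcell c x
      have hli : l ≠ i := by rintro rfl; exact hx hl
      rw [iInf_sq_eq_of_mem_voronoi (Wcell_subset_voronoi c l hl)]
      simpa [hli] using iInf_sq_le (Function.update c i m) x l
  have hin : Integrable (fun x => ⟪c i - m, x⟫) P := hid.const_inner _
  have hg : Integrable (fun x => ‖c i‖ ^ 2 - ‖m‖ ^ 2 - 2 * ⟪c i - m, x⟫) P :=
    (integrable_const _).sub (hin.const_mul 2)
  have hint := integral_mono (hb.integrable_iInf_sq _)
    ((hb.integrable_iInf_sq c).sub (hg.indicator hWm)) hpt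
  rw [integral_sub' (hb.integrable_iInf_sq c) (hg.indicator hWm), integral_indicator hWm,
    integral_sub (integrable_const _) (hin.const_mul 2).integrableOn, integral_const_mul,
    integral_inner hid.integrableOn, hpm, setIntegral_const, inner_smul_right, smul_eq_mul,
    measureReal_def, ← hp] at hint
  have hopt : distortion P k c ≤ distortion P k (Function.update c i m) := hc _
  unfold distortion at hopt
  have hsq : p * ‖c i - m‖ ^ 2 ≤ 0 := by
    have e : ‖c i - m‖ ^ 2 = ‖c i‖ ^ 2 - ‖m‖ ^ 2 - 2 * ⟪c i - m, m⟫ := by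
      rw [norm_sub_sq_real, inner_sub_left, real_inner_self_eq_norm_sq]; ring
    rw [e]
    linarith
  have : c i - m = 0 := by
    by_contra hne
    have := norm_pos_iff.2 hne
    have : 0 < p * ‖c i - m‖ ^ 2 := by positivity
    linarith
  rw [hpm, ← sub_eq_zero.1 this]

theorem norm_le_of_stationary [InnerProductSpace ℝ H] [IsProbabilityMeasure P] (hb : MBounded P M)
    {c : Fin k → H} (hc : c ∈ stationary P k) {i : Fin k} (hi : P (Wcell k c i) ≠ 0) :
    ‖c i‖ ≤ M := by
  have hp0 : 0 < (P (Wcell k c i)).toReal := ENNReal.toReal_pos hi (measure_ne_top _ _)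
  have h1 := norm_setIntegral_le_of_norm_le_const_ae' (μ := P) (s := Wcell k c i)
    (f := fun x => x) (C := M) (measure_lt_top _ _) (hb.ae_norm_le.mono fun x hx _ => hx)
  rw [← hc i, norm_smul, Real.norm_of_nonneg hp0.le, measureReal_def, mul_comm] at h1
  exact le_of_mul_le_mul_right h1 hp0

end Distortion

section Compactness

/-- Bounded sequences in a separable Hilbert space have weakly convergent subsequences. -/
theorem exists_subseq_tendsto_inner {E : Type*} [NormedAddCommGroup E] [InnerProductSpace ℝ E]
    [CompleteSpace E] [TopologicalSpace.SeparableSpace E] {u : ℕ → E} {R : ℝ}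
    (hu : ∀ n, ‖u n‖ ≤ R) :
    ∃ (a : E) (φ : ℕ → ℕ), StrictMono φ ∧
      ∀ x, Tendsto (fun n => ⟪u (φ n), x⟫) atTop (𝓝 ⟪a, x⟫) := by
  obtain ⟨f, -, φ, hφ, hlim⟩ := WeakDual.isSeqCompact_closedBall ℝ E (0 : StrongDual ℝ E) R
    (x := fun n => StrongDual.toWeakDual (InnerProductSpace.toDual ℝ E (u n)))
    (fun n => by
      simp only [Set.mem_preimage, mem_closedBall_zero_iff]
      exact ((InnerProductSpace.toDual ℝ E).norm_map (u n)).le.trans (hu n))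
  refine ⟨(InnerProductSpace.toDual ℝ E).symm (WeakDual.toStrongDual f), φ, hφ, fun x => ?_⟩
  rw [InnerProductSpace.toDual_symm_apply]
  exact ((WeakDual.eval_continuous x).tendsto f).comp hlim

theorem exists_subseq_tendsto_inner_pi {H : Type*} [NormedAddCommGroup H]
    [InnerProductSpace ℝ H] [CompleteSpace H] [SecondCountableTopology H] {k : ℕ}
    {c : ℕ → Fin k → H} {R : ℝ}
    (hc : ∀ n i, ‖c n i‖ ≤ R) :
    ∃ (s : Fin k → H) (φ : ℕ → ℕ), StrictMono φ ∧
      ∀ i x, Tendsto (fun n => ⟪c (φ n) i, x⟫) atTop (𝓝 ⟪s i, x⟫) := by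
  have hbound : ∀ n, ‖WithLp.toLp 2 (c n)‖ ≤ √(∑ _i : Fin k, R ^ 2) := fun n => by
    rw [PiLp.norm_eq_of_L2]
    exact Real.sqrt_le_sqrt (Finset.sum_le_sum fun i _ =>
      pow_le_pow_left₀ (norm_nonneg _) (hc n i) 2)
  obtain ⟨a, φ, hφ, h⟩ := exists_subseq_tendsto_inner hbound
  refine ⟨a.ofLp, φ, hφ, fun i x => ?_⟩
  have := h (WithLp.toLp 2 (Pi.single i x))
  have key : ∀ v : PiLp 2 fun _ : Fin k => H,
      ⟪v, WithLp.toLp 2 (Pi.single i x)⟫ = ⟪v.ofLp i, x⟫ := fun v => by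
    rw [PiLp.inner_apply, Finset.sum_eq_single i]
    · simp
    · intro j _ hj; simp [hj]
    · simp
  simpa only [key] using this

/-- Bounded minimizing sequences subconverge strongly to an optimal codebook, provided the
skeletons of optimal codebooks are negligible and their cells are not. -/
theorem exists_subseq_tendsto_optimal {H : Type*} [NormedAddCommGroup H]
    [InnerProductSpace ℝ H] [MeasurableSpace H] [BorelSpace H] [SecondCountableTopology H]
    [CompleteSpace H] {P : Measure H} [IsProbabilityMeasure P] {k : ℕ}
    [Nonempty (Fin k)] {M : ℝ} (hb : MBounded P M)
    (hN : ∀ s ∈ optimal P k, P (Ncrit k s) = 0)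
    (hV : ∀ s ∈ optimal P k, ∀ i, P (voronoi k s i) ≠ 0)
    {s₀ : Fin k → H} (hs₀ : s₀ ∈ optimal P k) {c : ℕ → Fin k → H} (hcM : ∀ n i, ‖c n i‖ ≤ M)
    (hR : Tendsto (fun n => distortion P k (c n)) atTop (𝓝 (distortion P k s₀))) :
    ∃ s ∈ optimal P k, ∃ φ : ℕ → ℕ, StrictMono φ ∧ Tendsto (c ∘ φ) atTop (𝓝 s) := by
  obtain ⟨s, φ, hφ, hw⟩ := exists_subseq_tendsto_inner_pi hcM
  obtain ⟨a, -, ψ, hψ, ha⟩ := tendsto_subseq_of_bounded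
    (isBounded_closedBall (x := (0 : Fin k → ℝ)) (r := M ^ 2))
    (x := fun n i => ‖c (φ n) i‖ ^ 2) (fun n => by
      rw [mem_closedBall_zero_iff, pi_norm_le_iff_of_nonneg (sq_nonneg M)]
      intro i
      rw [Real.norm_of_nonneg (sq_nonneg _)]
      exact pow_le_pow_left₀ (norm_nonneg _) (hcM _ _) 2)
  rw [tendsto_pi_nhds] at ha
  set δ : Fin k → ℝ := fun i => a i - ‖s i‖ ^ 2 with hδ
  have hlim : ∀ x i,
      Tendsto (fun n => ‖x - c (φ (ψ n)) i‖ ^ 2) atTop (𝓝 (‖x - s i‖ ^ 2 + δ i)) := by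
    intro x i
    have h1 : ∀ n, ‖x - c (φ (ψ n)) i‖ ^ 2 =
        ‖x‖ ^ 2 - 2 * ⟪c (φ (ψ n)) i, x⟫ + ‖c (φ (ψ n)) i‖ ^ 2 := fun n => by
      rw [norm_sub_sq_real, real_inner_comm]
    have h2 : ‖x - s i‖ ^ 2 + δ i = ‖x‖ ^ 2 - 2 * ⟪s i, x⟫ + a i := by
      rw [norm_sub_sq_real, real_inner_comm, hδ]; ring
    simp only [h1, h2]
    exact (((hw i x).comp hψ.tendsto_atTop).const_mul 2 |>.const_sub _).add (ha i)
  have hδ0 : ∀ i, 0 ≤ δ i := fun i => by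
    have := ge_of_tendsto' (hlim (s i) i) fun n => sq_nonneg _
    simpa using this
  have hinf : ∀ x, Tendsto (fun n => ⨅ i, ‖x - c (φ (ψ n)) i‖ ^ 2) atTop
      (𝓝 (⨅ i, (‖x - s i‖ ^ 2 + δ i))) := fun x => by
    simp only [← Finset.inf'_univ_eq_ciInf]
    exact Tendsto.finset_inf'_nhds_apply _ fun i _ => hlim x i
  have hM : 0 ≤ M := (norm_nonneg _).trans (hcM 0 (Classical.arbitrary _))
  have hle : ∀ x, ⨅ i, ‖x - s i‖ ^ 2 ≤ ⨅ i, (‖x - s i‖ ^ 2 + δ i) := fun x =>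
    le_ciInf fun i => (iInf_sq_le s x i).trans (by linarith [hδ0 i])
  have hbd : ∀ n, ∀ᵐ x ∂P, ‖⨅ i, ‖x - c (φ (ψ n)) i‖ ^ 2‖ ≤ (M + M) ^ 2 := fun n => by
    filter_upwards [hb.ae_norm_le] with x hx
    rw [Real.norm_of_nonneg (iInf_sq_nonneg _ x)]
    refine (iInf_sq_le _ x (Classical.arbitrary _)).trans (pow_le_pow_left₀ (norm_nonneg _) ?_ 2)
    exact (norm_sub_le _ _).trans (add_le_add hx (hcM _ _))
  have hint : Tendsto (fun n => distortion P k (c (φ (ψ n)))) atTop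
      (𝓝 (∫ x, ⨅ i, (‖x - s i‖ ^ 2 + δ i) ∂P)) :=
    tendsto_integral_of_dominated_convergence (fun _ => (M + M) ^ 2)
      (fun n => (measurable_iInf_sq _).aestronglyMeasurable) (integrable_const _) hbd
      (Eventually.of_forall hinf)
  have heq : ∫ x, ⨅ i, (‖x - s i‖ ^ 2 + δ i) ∂P = distortion P k s₀ :=
    tendsto_nhds_unique hint (hR.comp (hφ.comp hψ).tendsto_atTop)
  have hgm : Measurable fun x => ⨅ i, (‖x - s i‖ ^ 2 + δ i) :=
    Measurable.iInf fun i => by fun_prop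
  have hgi : Integrable (fun x => ⨅ i, (‖x - s i‖ ^ 2 + δ i)) P := by
    refine Integrable.of_bound hgm.aestronglyMeasurable ((M + M) ^ 2) ?_
    filter_upwards [ae_all_iff.2 hbd] with x hx
    exact le_of_tendsto' (hinf x).norm hx
  have hsi := hb.integrable_iInf_sq s
  have hss₀ : distortion P k s ≤ distortion P k s₀ :=
    heq ▸ integral_mono hsi hgi hle
  have hs : s ∈ optimal P k := fun d => hss₀.trans (hs₀ d)
  have hae : ∀ᵐ x ∂P, ⨅ i, ‖x - s i‖ ^ 2 = ⨅ i, (‖x - s i‖ ^ 2 + δ i) :=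
    (integral_eq_iff_of_ae_le hsi hgi (Eventually.of_forall hle)).1
      (le_antisymm (integral_mono hsi hgi hle) (heq ▸ hs₀ s))
  have hδz : ∀ j, δ j = 0 := by
    intro j
    obtain ⟨x, hxj, hx, hxN⟩ : ∃ x ∈ voronoi k s j,
        (⨅ i, ‖x - s i‖ ^ 2 = ⨅ i, (‖x - s i‖ ^ 2 + δ i)) ∧ x ∉ Ncrit k s := by
      by_contra! hcon
      refine hV s hs j (measure_mono_null (t := {x | ¬ (⨅ i, ‖x - s i‖ ^ 2 =
        ⨅ i, (‖x - s i‖ ^ 2 + δ i))} ∪ Ncrit k s) (fun x hx => ?_)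
        (measure_union_null hae (hN s hs)))
      by_cases h : ⨅ i, ‖x - s i‖ ^ 2 = ⨅ i, (‖x - s i‖ ^ 2 + δ i)
      · exact Or.inr (hcon x hx h)
      · exact Or.inl h
    obtain ⟨i, hi⟩ := exists_eq_ciInf_of_finite (f := fun i => ‖x - s i‖ ^ 2 + δ i)
    rw [iInf_sq_eq_of_mem_voronoi hxj, ← hi] at hx
    have hji : ‖x - s j‖ ^ 2 ≤ ‖x - s i‖ ^ 2 := pow_le_pow_left₀ (norm_nonneg _) (hxj i) 2
    have hij : ‖x - s i‖ = ‖x - s j‖ :=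
      (sq_eq_sq₀ (norm_nonneg _) (norm_nonneg _)).1 (by linarith [hδ0 i])
    by_cases h : i = j
    · subst h; linarith
    · exact (hxN (by simp only [Ncrit, Set.mem_iUnion]; exact ⟨i, j, h, hij⟩)).elim
  refine ⟨s, hs, φ ∘ ψ, hφ.comp hψ, tendsto_pi_nhds.2 fun i => ?_⟩
  have h := hlim (s i) i
  rw [hδz i, sub_self, norm_zero, zero_pow two_ne_zero, add_zero] at h
  have h' := h.sqrt
  simp only [Real.sqrt_sq (norm_nonneg _), Real.sqrt_zero] at h'
  refine tendsto_iff_norm_sub_tendsto_zero.2 ?_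
  simpa only [Function.comp_apply, norm_sub_rev] using h'

end Compactness

section Margin

variable {H : Type*} [NormedAddCommGroup H] [MeasurableSpace H] {P : Measure H} {k : ℕ} {M r₀ : ℝ}

theorem Bsep_le {s : Fin k → H} (hs : s ∈ optimal P k) {i j : Fin k} (hij : i ≠ j) :
    Bsep P k ≤ ‖s i - s j‖ := by
  refine csInf_le ⟨0, ?_⟩ ⟨s, hs, i, j, hij, rfl⟩
  rintro _ ⟨c, -, i, j, -, rfl⟩
  exact norm_nonneg _

theorem pmin_le {s : Fin k → H} (hs : s ∈ optimal P k) (i : Fin k) :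
    pmin P k ≤ P.real (voronoi k s i) := by
  refine csInf_le ⟨0, ?_⟩ ⟨s, hs, i, rfl⟩
  rintro _ ⟨c, -, j, rfl⟩
  exact measureReal_nonneg

theorem pmin_nonneg : 0 ≤ pmin P k := by
  refine Real.sInf_nonneg ?_
  rintro _ ⟨c, -, j, rfl⟩
  exact measureReal_nonneg

variable [IsProbabilityMeasure P]

theorem MarginCondition.measure_infDist_le (h : MarginCondition P k M r₀) {s : Fin k → H}
    (hs : s ∈ optimal P k) {t : ℝ} (ht : 0 ≤ t) (ht' : t ≤ r₀) :
    P.real {x | infDist x (Ncrit k s) ≤ t} ≤ Bsep P k * pmin P k * t / (128 * M ^ 2) := by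
  have hbdd : BddAbove {r : ℝ | ∃ c ∈ optimal P k,
      r = (P {x : H | infDist x (Ncrit k c) ≤ t}).toReal} := by
    refine ⟨1, ?_⟩
    rintro _ ⟨c, -, rfl⟩
    exact measureReal_le_one
  exact (le_csSup hbdd ⟨s, hs, rfl⟩).trans (h.2.2 t ht ht')

theorem MarginCondition.measure_infDist_nonpos (h : MarginCondition P k M r₀) {s : Fin k → H}
    (hs : s ∈ optimal P k) : P {x | infDist x (Ncrit k s) ≤ 0} = 0 := by
  have := h.measure_infDist_le hs le_rfl h.1.le
  rw [mul_zero, zero_div] at this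
  exact (measureReal_eq_zero_iff).1 (le_antisymm this measureReal_nonneg)

theorem MarginCondition.measure_Ncrit (h : MarginCondition P k M r₀) {s : Fin k → H}
    (hs : s ∈ optimal P k) : P (Ncrit k s) = 0 :=
  measure_mono_null (fun _ hx => (infDist_zero_of_mem hx).le) (h.measure_infDist_nonpos hs)

theorem MarginCondition.injective (h : MarginCondition P k M r₀) {s : Fin k → H}
    (hs : s ∈ optimal P k) : Function.Injective s := by
  intro i j hij
  by_contra hne
  have : Ncrit k s = Set.univ := Set.eq_univ_of_forall fun x => by
    simp only [Ncrit, Set.mem_iUnion]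
    exact ⟨i, j, hne, by simp [hij]⟩
  simpa [this] using h.measure_Ncrit hs

theorem MarginCondition.exists_ne (h : MarginCondition P k M r₀) {s : Fin k → H}
    (hs : s ∈ optimal P k) : ∃ i j : Fin k, i ≠ j := by
  by_contra! hcon
  have hempty : Ncrit k s = ∅ := by
    simp only [Ncrit, Set.iUnion_eq_empty]
    exact fun i j hij => (hij (hcon i j)).elim
  simpa [hempty] using h.measure_infDist_nonpos hs

/-- Under the margin condition, optimal codebooks are isolated among stationary ones. -/
theorem MarginCondition.exists_isolated [InnerProductSpace ℝ H] [BorelSpace H]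
    [SecondCountableTopology H] [CompleteSpace H] [Nonempty (Fin k)] (h : MarginCondition P k M r₀)
    (hM : 0 < M) (hsupp : SupportMoreThan P k) {s : Fin k → H} (hs : s ∈ optimal P k) :
    ∃ η > 0, ∀ c ∈ stationary P k, ‖c - s‖ ≤ η → c = s := by
  have hb : MBounded P M := h.2.1
  have hr := h.1
  have hinj := h.injective hs
  have hVW : ∀ i, P.real (voronoi k s i) = P.real (Wcell k s i) := fun i => by
    refine measureReal_congr (EventuallyLE.antisymm ?_ (Wcell_subset_voronoi s i).eventuallyLE)
    refine ae_le_set.2 (measure_mono_null (voronoi_diff_Wcell_subset s i) (h.measure_Ncrit hs))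
  obtain ⟨b, hb0, hBb, hbs⟩ : ∃ b > 0, Bsep P k ≤ b ∧ ∀ i j, i ≠ j → b ≤ ‖s i - s j‖ := by
    obtain ⟨i, j, hij⟩ := h.exists_ne hs
    have : Nonempty {p : Fin k × Fin k // p.1 ≠ p.2} := ⟨⟨(i, j), hij⟩⟩
    obtain ⟨⟨p, hp⟩, hmin⟩ := Finite.exists_min
      fun p : {p : Fin k × Fin k // p.1 ≠ p.2} => ‖s p.1.1 - s p.1.2‖
    exact ⟨_, norm_pos_iff.2 (sub_ne_zero.2 (hinj.ne hp)), Bsep_le hs hp,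
      fun i j hij => hmin ⟨(i, j), hij⟩⟩
  obtain ⟨q, hq0, hpq, hqs⟩ : ∃ q > 0, pmin P k ≤ q ∧ ∀ i, q ≤ P.real (Wcell k s i) := by
    obtain ⟨i, hi⟩ := Finite.exists_min fun i => P.real (voronoi k s i)
    refine ⟨_, ?_, pmin_le hs i, fun j => (hi j).trans (hVW j).le⟩
    exact ENNReal.toReal_pos (measure_voronoi_ne_zero hb hsupp hs i) (measure_ne_top _ _)
  have hsst := optimal_subset_stationary hb hs
  have hsM : ∀ i, ‖s i‖ ≤ M := fun i => norm_le_of_stationary hb hsst fun h0 => by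
    have := hqs i
    rw [measureReal_def, h0] at this
    simp at this
    linarith
  refine ⟨min M (b * r₀ / (4 * M)), by positivity, fun c hc hcs => ?_⟩
  set e := ‖c - s‖ with he
  have heM : e ≤ M := hcs.trans (min_le_left _ _)
  have hei : ∀ i, ‖c i - s i‖ ≤ e := norm_le_pi_norm (c - s)
  have he0 : 0 ≤ e := norm_nonneg _
  set t := 4 * M * e / b with ht
  have ht0 : 0 ≤ t := by positivity
  have htr : t ≤ r₀ := by
    have := hcs.trans (min_le_right _ _)
    rw [le_div_iff₀ (by positivity)] at this
    rw [ht, div_le_iff₀ hb0]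
    linarith
  set T := {x | infDist x (Ncrit k s) ≤ t}
  have hTm : MeasurableSet T :=
    (isClosed_le (continuous_infDist_pt _) continuous_const).measurableSet
  have hPT : P.real T ≤ q * e / (32 * M) := by
    refine (h.measure_infDist_le hs ht0 htr).trans ?_
    have h1 : Bsep P k * pmin P k ≤ b * q := mul_le_mul hBb hpq pmin_nonneg hb0.le
    calc Bsep P k * pmin P k * t / (128 * M ^ 2) ≤ b * q * t / (128 * M ^ 2) := by gcongr
      _ = q * e / (32 * M) := by rw [ht]; field_simp; ring
  have hgeom : ∀ x, ‖x‖ ≤ M → ∀ i j, i ≠ j → x ∈ voronoi k c i → x ∈ voronoi k s j → x ∈ T := by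
    intro x hx i j hij hxi hxj
    refine infDist_Ncrit_le (hinj.ne hij) (hxj i) ?_
    have h1 : ‖x - s i‖ ≤ ‖x - s j‖ + 2 * e := by
      have t1 := norm_sub_le_norm_sub_add_norm_sub x (c i) (s i)
      have t2 := norm_sub_le_norm_sub_add_norm_sub x (s j) (c j)
      rw [norm_sub_rev (s j)] at t2
      linarith [hei i, hei j, hxi j]
    have h2 : ‖x - s i‖ ≤ 2 * M := (norm_sub_le _ _).trans (by linarith [hsM i])
    have h3 : ‖x - s j‖ ≤ 2 * M := (norm_sub_le _ _).trans (by linarith [hsM j])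
    have h4 : 2 * t * b ≤ 2 * t * ‖s i - s j‖ := by
      gcongr
      exact hbs i j hij
    have h5 : 2 * t * b = 8 * M * e := by rw [ht]; field_simp; ring
    have h6 := norm_nonneg (x - s i)
    have h7 := norm_nonneg (x - s j)
    nlinarith [mul_nonneg he0 (by linarith : 0 ≤ 4 * M - ‖x - s i‖ - ‖x - s j‖),
      mul_nonneg (by linarith : 0 ≤ ‖x - s j‖ + 2 * e - ‖x - s i‖) (add_nonneg h6 h7)]
  have hWc := measurableSet_Wcell c
  have hWs := measurableSet_Wcell s
  have hmem : ∀ x, ‖x‖ ≤ M → x ∉ T → ∀ i, (x ∈ Wcell k c i ↔ x ∈ Wcell k s i) := by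
    intro x hx hxT i
    obtain ⟨j, hj⟩ := exists_mem_Wcell c x
    obtain ⟨l, hl⟩ := exists_mem_Wcell s x
    constructor
    · intro hi
      by_cases hil : i = l
      · exact hil ▸ hl
      · exact (hxT (hgeom x hx i l hil hi.1 hl.1)).elim
    · intro hi
      by_cases hji : j = i
      · exact hji ▸ hj
      · exact (hxT (hgeom x hx j i hji hj.1 hi.1)).elim
  have hkey : ∀ i, ‖c i - s i‖ ≤ e / 8 := by
    intro i
    set A := Wcell k c i
    set A' := Wcell k s i
    have hmass : q / 2 ≤ P.real A := by
      have h1 : P.real A' ≤ P.real (A ∪ T) := by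
        refine ENNReal.toReal_mono (measure_ne_top _ _) (measure_mono_ae ?_)
        filter_upwards [hb.ae_norm_le] with x hx hxA
        by_cases hxT : x ∈ T
        · exact Or.inr hxT
        · exact Or.inl ((hmem x hx hxT i).2 hxA)
      have h2 := measureReal_union_le (μ := P) A T
      have h3 : q * e / (32 * M) ≤ q / 2 := by
        rw [div_le_div_iff₀ (by positivity) (by norm_num)]
        nlinarith
      linarith [hqs i]
    set g : H → H := fun x => x - s i
    have hgi : Integrable g P := hb.integrable_id.sub (integrable_const _)
    have hcell : ∀ d : Fin k → H, d ∈ stationary P k →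
        ∫ x, (Wcell k d i).indicator g x ∂P = P.real (Wcell k d i) • (d i - s i) := by
      intro d hd
      rw [integral_indicator (measurableSet_Wcell d i), integral_sub
        hb.integrable_id.integrableOn (integrable_const _), ← hd i, setIntegral_const,
        measureReal_def, smul_sub]
    have hvec : P.real A • (c i - s i) = ∫ x, (A.indicator g x - A'.indicator g x) ∂P := by
      rw [integral_sub (hgi.indicator (hWc i)) (hgi.indicator (hWs i)), hcell c hc, hcell s hsst,
        sub_self, smul_zero, sub_zero]
    have hnorm : ‖P.real A • (c i - s i)‖ ≤ ∫ x, T.indicator (fun _ => 2 * M) x ∂P := by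
      rw [hvec]
      refine norm_integral_le_of_norm_le ((integrable_const _).indicator hTm) ?_
      filter_upwards [hb.ae_norm_le] with x hx
      by_cases hxT : x ∈ T
      · have hgx : ‖g x‖ ≤ 2 * M := (norm_sub_le _ _).trans (by linarith [hsM i])
        rw [Set.indicator_of_mem hxT]
        by_cases h1 : x ∈ A <;> by_cases h2 : x ∈ A' <;> simp [h1, h2, hgx, hM.le]
      · rw [Set.indicator_of_notMem hxT]
        have : x ∈ A ↔ x ∈ A' := hmem x hx hxT i
        by_cases h1 : x ∈ A
        · simp [h1, this.1 h1]
        · have h2 : x ∉ A' := fun h2 => h1 (this.2 h2)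
          simp [h1, h2]
    rw [integral_indicator hTm, setIntegral_const, norm_smul, smul_eq_mul,
      Real.norm_of_nonneg measureReal_nonneg] at hnorm
    have h1 : P.real T * (2 * M) ≤ q * e / 16 := by
      refine (mul_le_mul_of_nonneg_right hPT (by positivity)).trans (le_of_eq ?_)
      field_simp; ring
    have h2 : q / 2 * ‖c i - s i‖ ≤ P.real A * ‖c i - s i‖ :=
      mul_le_mul_of_nonneg_right hmass (norm_nonneg _)
    have h3 : q * ‖c i - s i‖ ≤ q * (e / 8) := by linarith
    exact le_of_mul_le_mul_left h3 hq0
  have : e ≤ e / 8 := (pi_norm_le_iff_of_nonneg (by positivity)).2 hkey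
  have h0 : ‖c - s‖ = 0 := by linarith
  exact sub_eq_zero.1 (norm_eq_zero.1 h0)

/-- Under the margin condition, a minimizing sequence of stationary codebooks visits an optimal
codebook infinitely often. -/
theorem MarginCondition.exists_subseq_eq [InnerProductSpace ℝ H] [BorelSpace H]
    [SecondCountableTopology H] [CompleteSpace H] [Nonempty (Fin k)] (h : MarginCondition P k M r₀)
    (hM : 0 < M) (hsupp : SupportMoreThan P k) {s₀ : Fin k → H} (hs₀ : s₀ ∈ optimal P k)
    {c : ℕ → Fin k → H} (hc : ∀ n, c n ∈ stationary P k)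
    (hR : Tendsto (fun n => distortion P k (c n)) atTop (𝓝 (distortion P k s₀))) :
    ∃ s ∈ optimal P k, ∃ φ : ℕ → ℕ, StrictMono φ ∧ ∀ᶠ n in atTop, c (φ n) = s := by
  have hb : MBounded P M := h.2.1
  have hnn : ∀ n, ∃ j, P (Wcell k (c n) j) ≠ 0 := by
    intro n
    by_contra! hcon
    have := measure_iUnion_null hcon
    rw [Set.eq_univ_of_forall fun x => Set.mem_iUnion.2 (exists_mem_Wcell (c n) x)] at this
    simp at this
  choose j hj using hnn
  set d : ℕ → Fin k → H := fun n i =>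
    if P (Wcell k (c n) i) = 0 then c n (j n) else c n i with hd
  have hdM : ∀ n i, ‖d n i‖ ≤ M := by
    intro n i
    by_cases h0 : P (Wcell k (c n) i) = 0
    · simpa [hd, h0] using norm_le_of_stationary hb (hc n) (hj n)
    · simpa [hd, h0] using norm_le_of_stationary hb (hc n) h0
  have hdc : ∀ n, distortion P k (d n) ≤ distortion P k (c n) := by
    intro n
    refine integral_mono_ae (hb.integrable_iInf_sq _) (hb.integrable_iInf_sq _) ?_
    have hz : ∀ᵐ x ∂P, ∀ i, P (Wcell k (c n) i) = 0 → x ∉ Wcell k (c n) i := by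
      refine ae_all_iff.2 fun i => ?_
      by_cases h0 : P (Wcell k (c n) i) = 0
      · filter_upwards [compl_mem_ae_iff.2 h0] with x hx _ using hx
      · exact Eventually.of_forall fun x h => (h0 h).elim
    filter_upwards [hz] with x hx
    obtain ⟨l, hl⟩ := exists_mem_Wcell (c n) x
    have h0 : P (Wcell k (c n) l) ≠ 0 := fun h0 => hx l h0 hl
    rw [iInf_sq_eq_of_mem_voronoi (Wcell_subset_voronoi _ _ hl)]
    simpa [hd, h0] using iInf_sq_le (d n) x l
  have hdR := tendsto_of_tendsto_of_tendsto_of_le_of_le tendsto_const_nhds hR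
    (fun n => hs₀ (d n)) hdc
  obtain ⟨s, hs, φ, hφ, hlim⟩ := exists_subseq_tendsto_optimal hb
    (fun s hs => h.measure_Ncrit hs) (fun s hs => measure_voronoi_ne_zero hb hsupp hs)
    hs₀ hdM hdR
  obtain ⟨η, hη, hiso⟩ := h.exists_isolated hM hsupp hs
  refine ⟨s, hs, φ, hφ, ?_⟩
  have hne : ∀ᶠ n in atTop, ∀ i l, i ≠ l → d (φ n) i ≠ d (φ n) l := by
    refine eventually_all.2 fun i => eventually_all.2 fun l => ?_
    by_cases hil : i = l
    · exact Eventually.of_forall fun n h => (h hil).elim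
    · have := (tendsto_pi_nhds.1 hlim i).prodMk_nhds (tendsto_pi_nhds.1 hlim l)
      filter_upwards [this.eventually (isOpen_ne_fun continuous_fst continuous_snd |>.mem_nhds
        ((h.injective hs).ne hil))] with n hn _ using hn
  filter_upwards [hne, hlim.eventually (closedBall_mem_nhds s hη)] with n hn hball
  have hdn : d (φ n) = c (φ n) := by
    funext i
    by_cases h0 : P (Wcell k (c (φ n)) i) = 0
    · have hij : i ≠ j (φ n) := by
        intro hij
        rw [hij] at h0
        exact hj _ h0
      exact (hn i (j (φ n)) hij (by simp [hd, h0])).elim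
    · simp [hd, h0]
  refine hiso _ (hc _) ?_
  rw [← hdn, ← dist_eq_norm]
  exact hball

end Margin

end Kmeans

open Kmeans

variable {H : Type*} [NormedAddCommGroup H] [InnerProductSpace ℝ H]
  [MeasurableSpace H] [BorelSpace H] [SecondCountableTopology H] [CompleteSpace H]

/-- under the margin condition, the set of optimal codebooks is
finite and the distribution is `ε`-separated for some `ε > 0`. -/
theorem optimal_finite_and_separated_of_margin
    (P : Measure H) [IsProbabilityMeasure P] (k : ℕ) (M r₀ : ℝ)
    (hk : 1 ≤ k) (hM : 0 < M) (hsupp : SupportMoreThan P k)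
    (hmargin : MarginCondition P k M r₀) :
    (optimal P k).Finite ∧ ∃ ε : ℝ, 0 < ε ∧ Separated P k ε := by
  have : Nonempty (Fin k) := ⟨⟨0, hk⟩⟩
  have hb : MBounded P M := hmargin.2.1
  constructor
  · by_contra hinf
    have hinf : (optimal P k).Infinite := hinf
    set c := hinf.natEmbedding
    obtain ⟨s, -, φ, hφ, hev⟩ := hmargin.exists_subseq_eq hM hsupp (c 0).2
      (c := fun n => (c n).1) (fun n => optimal_subset_stationary hb (c n).2)
      (tendsto_const_nhds.congr fun n => le_antisymm ((c 0).2 _) ((c n).2 _))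
    obtain ⟨N, hN⟩ := Filter.eventually_atTop.1 hev
    have heq := Subtype.ext ((hN N le_rfl).trans (hN (N + 1) N.le_succ).symm)
    exact (hφ N.lt_succ_self).ne (c.injective heq)
  · by_contra! hcon
    have hcon' : ∀ n : ℕ, ∃ c ∈ stationary P k \ optimal P k, ∃ s ∈ optimal P k,
        distortion P k c - distortion P k s < 1 / ((n : ℝ) + 1) := by
      intro n
      simpa only [Separated, not_forall, not_le, exists_prop] using
        hcon (1 / ((n : ℝ) + 1)) (by positivity)
    choose c hc s hs hlt using hcon'
    have hR : Filter.Tendsto (fun n => distortion P k (c n)) Filter.atTop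
        (nhds (distortion P k (s 0))) := by
      refine tendsto_of_tendsto_of_tendsto_of_le_of_le tendsto_const_nhds
        (h := fun n : ℕ => distortion P k (s 0) + 1 / ((n : ℝ) + 1)) ?_ (fun n => hs 0 _) fun n => ?_
      · simpa using tendsto_one_div_add_atTop_nhds_zero_nat.const_add (distortion P k (s 0))
      · have := hlt n
        have := hs n (s 0)
        simp only
        linarith
    obtain ⟨s', hs', φ, -, hev⟩ := hmargin.exists_subseq_eq hM hsupp (hs 0)
      (fun n => (hc n).1) hR
    obtain ⟨n, hn⟩ := hev.exists
    exact (hc (φ n)).2 (hn ▸ hs')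
end
end
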